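/- (Theorem 3, restricted strongly convex case, one-step recurrence) Suppose f := Σ_{i=1}^n f_i is restricted strongly convex with modulus ν_f > 0, i.e., ⟨∇f(x) − ∇f(x*), x − x*⟩ ≥ ν_f ‖x − x*‖² for all x ∈ ℝ^p, where x* = Proj_{X*}(x) and ∇f(x*) = 0. Fix θ ∈ [0,1] and set ν_f̄ := ν_f/n, c₁ := θ/L_f̄, c₂ := (1 − θ) ν_f̄. If α ≤ min{(1 + λ_n(W))/L_h, c₁} and β < 1, then for every δ > 0 and all k ≥ 0: ‖ē(k+1)‖² ≤ (1 − α c₂ + α δ − α² δ c₂) ‖ē(k)‖² + α³ (α + δ⁻¹) L_h² D² / (1 − β)². -/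

import Mathlib

open scoped RealInnerProductSpace

section aux
variable {E : Type*} [NormedAddCommGroup E] [InnerProductSpace ℝ E] [CompleteSpace E]

theorem aux_lineDeriv (F : E → ℝ) (G : E → E) (hg : ∀ z, HasGradientAt F (G z) z) (x d : E) (t : ℝ) :
    HasDerivAt (fun t : ℝ => F (x + t • d)) ⟪G (x + t • d), d⟫ t := by
  have h1 : HasDerivAt (fun t : ℝ => x + t • d) d t := by
    simpa using ((hasDerivAt_id t).smul_const d).const_add x
  have h2 := (hg (x + t • d)).hasFDerivAt.comp_hasDerivAt t h1
  simp only [InnerProductSpace.toDual_apply_apply] at h2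
  exact h2

theorem aux_smooth (F : E → ℝ) (G : E → E) (L : ℝ) (hg : ∀ z, HasGradientAt F (G z) z)
    (hL : ∀ a b, ‖G a - G b‖ ≤ L * ‖a - b‖) (x y : E) :
    F y ≤ F x + ⟪G x, y - x⟫ + L / 2 * ‖y - x‖ ^ 2 := by
  set d := y - x with hd
  let ψ : ℝ → ℝ := fun t => F (x + t • d) - t * ⟪G x, d⟫ - L / 2 * ‖d‖ ^ 2 * t ^ 2
  have hψ : ∀ t, HasDerivAt ψ (⟪G (x + t • d), d⟫ - ⟪G x, d⟫ - L * ‖d‖ ^ 2 * t) t := by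
    intro t
    have h := ((aux_lineDeriv F G hg x d t).sub ((hasDerivAt_id t).mul_const ⟪G x, d⟫)).sub
      ((hasDerivAt_pow 2 t).const_mul (L / 2 * ‖d‖ ^ 2))
    refine h.congr_deriv ?_
    simp; ring
  have hanti : AntitoneOn ψ (Set.Icc 0 1) := by
    apply antitoneOn_of_deriv_nonpos (convex_Icc 0 1)
    · exact fun t _ => (hψ t).continuousAt.continuousWithinAt
    · exact fun t _ => (hψ t).differentiableAt.differentiableWithinAt
    · intro t ht
      rw [interior_Icc] at ht
      rw [(hψ t).deriv, ← inner_sub_left]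
      have h1 := real_inner_le_norm (G (x + t • d) - G x) d
      have h2 := hL (x + t • d) x
      rw [add_sub_cancel_left, norm_smul, Real.norm_eq_abs, abs_of_pos ht.1] at h2
      have h3 := mul_le_mul_of_nonneg_right h2 (norm_nonneg d)
      nlinarith
  have h := hanti (Set.left_mem_Icc.2 zero_le_one) (Set.right_mem_Icc.2 zero_le_one) zero_le_one
  simp only [ψ, zero_smul, one_smul, add_zero, hd, add_sub_cancel] at h
  simp only [hd]
  linarith

theorem aux_grad_bound (F : E → ℝ) (G : E → E) (L : ℝ) (hLp : 0 < L)
    (hg : ∀ z, HasGradientAt F (G z) z)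
    (hL : ∀ a b, ‖G a - G b‖ ≤ L * ‖a - b‖) (m : ℝ) (hm : ∀ z, m ≤ F z) (x : E) :
    ‖G x‖ ^ 2 ≤ 2 * L * (F x - m) := by
  have h := aux_smooth F G L hg hL x (x - L⁻¹ • G x)
  have h2 := hm (x - L⁻¹ • G x)
  rw [sub_sub_cancel_left, inner_neg_right, inner_smul_right, real_inner_self_eq_norm_sq, norm_neg,
    norm_smul, Real.norm_eq_abs, abs_of_pos (inv_pos.2 hLp)] at h
  have h3 : m ≤ F x - ‖G x‖ ^ 2 / (2 * L) := by
    refine (h2.trans h).trans (le_of_eq ?_)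
    field_simp; ring
  have h4 : ‖G x‖ ^ 2 / (2 * L) ≤ F x - m := by linarith
  rw [div_le_iff₀ (by positivity)] at h4
  linarith

theorem aux_first_order (F : E → ℝ) (G : E → E) (hc : ConvexOn ℝ Set.univ F)
    (hg : ∀ z, HasGradientAt F (G z) z) (x y : E) :
    F x + ⟪G x, y - x⟫ ≤ F y := by
  have hc' : ConvexOn ℝ Set.univ (fun t : ℝ => F (x + t • (y - x))) := by
    have := hc.comp_affineMap (AffineMap.lineMap x y : ℝ →ᵃ[ℝ] E)
    have e : (fun t : ℝ => F (x + t • (y - x))) = F ∘ (AffineMap.lineMap x y : ℝ →ᵃ[ℝ] E) := by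
      funext t
      simp [AffineMap.lineMap_apply, add_comm]
    rw [e]; exact this
  have hd := aux_lineDeriv F G hg x (y - x) 0
  have := hc'.deriv_le_slope (Set.mem_univ 0) (Set.mem_univ 1) one_pos hd.differentiableAt
  rw [hd.deriv] at this
  simp [slope_def_field] at this
  linarith

theorem aux_min_grad (F : E → ℝ) (G : E → E) (hg : ∀ z, HasGradientAt F (G z) z) (x : E)
    (hm : ∀ z, F x ≤ F z) : G x = 0 := by
  have h : IsLocalMin F x := Filter.Eventually.of_forall hm
  have := h.hasFDerivAt_eq_zero (hg x).hasFDerivAt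
  simpa using this
end aux

theorem aux_spec {n : ℕ} (W : Matrix (Fin n) (Fin n) ℝ) (hW : W.IsHermitian) (u : EuclideanSpace ℝ (Fin n))
    (j : Fin n) : ⟪hW.eigenvectorBasis j, WithLp.toLp 2 (W.mulVec u)⟫ =
      hW.eigenvalues j * ⟪hW.eigenvectorBasis j, u⟫ := by
  have h := hW.mulVec_eigenvectorBasis j
  have hT : W.transpose = W := by
    have h0 : W.IsSymm := by simpa using hW
    exact h0
  simp only [EuclideanSpace.inner_eq_star_dotProduct, star_trivial]
  change dotProduct (W.mulVec u) _ = _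
  rw [dotProduct_comm, Matrix.dotProduct_mulVec, ← Matrix.mulVec_transpose, hT, h, smul_dotProduct,
    dotProduct_comm, smul_eq_mul]

theorem aux_low {n : ℕ} (W : Matrix (Fin n) (Fin n) ℝ) (hW : W.IsHermitian) (m : ℝ)
    (hm : ∀ j, m ≤ hW.eigenvalues j) (u : Fin n → ℝ) :
    m * ∑ i, u i ^ 2 ≤ ∑ i, u i * ∑ j, W i j * u j := by
  have h1 := hW.eigenvectorBasis.sum_inner_mul_inner (WithLp.toLp 2 u) (WithLp.toLp 2 u)
  have h2 := hW.eigenvectorBasis.sum_inner_mul_inner (WithLp.toLp 2 u) (WithLp.toLp 2 (W.mulVec u))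
  have e1 : ⟪WithLp.toLp 2 u, WithLp.toLp 2 u⟫ = ∑ i, u i ^ 2 := by
    rw [PiLp.inner_apply]; simp [pow_two]
  have e2 : ⟪WithLp.toLp 2 u, WithLp.toLp 2 (W.mulVec u)⟫ = ∑ i, u i * ∑ j, W i j * u j := by
    simp [PiLp.inner_apply, Matrix.mulVec, dotProduct, mul_comm]
  rw [← e1, ← e2, ← h1, ← h2, Finset.mul_sum]
  refine Finset.sum_le_sum fun j _ => ?_
  rw [aux_spec W hW (WithLp.toLp 2 u) j, real_inner_comm]
  nlinarith [hm j, mul_self_nonneg ⟪hW.eigenvectorBasis j, WithLp.toLp 2 u⟫]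

theorem aux_contr {n : ℕ} (hn : 0 < n) (W : Matrix (Fin n) (Fin n) ℝ) (hW : W.IsHermitian)
    (hrow : ∀ i, ∑ j, W i j = 1) (j0 : Fin n) (β : ℝ) (hβ : β < 1)
    (hm : ∀ j, j ≠ j0 → |hW.eigenvalues j| ≤ β) (u : Fin n → ℝ) (hu : ∑ i, u i = 0) :
    ∑ i, (∑ j, W i j * u j) ^ 2 ≤ β ^ 2 * ∑ i, u i ^ 2 := by
  have hone : W.mulVec (fun _ => 1) = fun _ => 1 := by
    ext i; simp [Matrix.mulVec, dotProduct, hrow]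
  have hz : ∀ j, j ≠ j0 → ⟪hW.eigenvectorBasis j, WithLp.toLp 2 (fun _ => (1 : ℝ))⟫ = 0 := by
    intro j hj
    have := aux_spec W hW (WithLp.toLp 2 (fun _ => (1 : ℝ))) j
    change ⟪_, WithLp.toLp 2 (W.mulVec (fun _ => 1))⟫ = _ at this
    rw [hone] at this
    have h1 : hW.eigenvalues j < 1 := (le_abs_self _).trans_lt ((hm j hj).trans_lt hβ)
    have h2 : (1 - hW.eigenvalues j) * ⟪hW.eigenvectorBasis j, WithLp.toLp 2 (fun _ => (1 : ℝ))⟫ = 0 := by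
      linarith
    rcases mul_eq_zero.1 h2 with h | h
    · linarith
    · exact h
  have h11 := hW.eigenvectorBasis.sum_inner_mul_inner (WithLp.toLp 2 (fun _ => (1 : ℝ))) (WithLp.toLp 2 (fun _ => (1 : ℝ)))
  rw [Finset.sum_eq_single j0 (fun j _ hj => by rw [hz j hj, mul_zero]) (by simp)] at h11
  have hu1 := hW.eigenvectorBasis.sum_inner_mul_inner (WithLp.toLp 2 u) (WithLp.toLp 2 (fun _ => (1 : ℝ)))
  rw [Finset.sum_eq_single j0 (fun j _ hj => by rw [hz j hj, mul_zero]) (by simp)] at hu1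
  have e11 : ⟪WithLp.toLp 2 (fun _ : Fin n => (1 : ℝ)), WithLp.toLp 2 (fun _ => (1 : ℝ))⟫ = n := by
    rw [PiLp.inner_apply]; simp
  have eu1 : ⟪WithLp.toLp 2 u, WithLp.toLp 2 (fun _ => (1 : ℝ))⟫ = 0 := by
    simp [PiLp.inner_apply, hu]
  rw [e11] at h11
  rw [eu1] at hu1
  have hne : ⟪hW.eigenvectorBasis j0, WithLp.toLp 2 (fun _ => (1 : ℝ))⟫ ≠ 0 := by
    intro h; rw [h, mul_zero] at h11
    have : (0 : ℝ) < n := by exact_mod_cast hn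
    linarith
  have hu0 : ⟪hW.eigenvectorBasis j0, WithLp.toLp 2 u⟫ = 0 := by
    rw [real_inner_comm]; exact (mul_eq_zero.1 hu1).resolve_right hne
  have h1 := hW.eigenvectorBasis.sum_inner_mul_inner (WithLp.toLp 2 u) (WithLp.toLp 2 u)
  have h2 := hW.eigenvectorBasis.sum_inner_mul_inner (WithLp.toLp 2 (W.mulVec u)) (WithLp.toLp 2 (W.mulVec u))
  have e1 : ⟪WithLp.toLp 2 u, WithLp.toLp 2 u⟫ = ∑ i, u i ^ 2 := by
    rw [PiLp.inner_apply]; simp [pow_two]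
  have e2 : ⟪WithLp.toLp 2 (W.mulVec u), WithLp.toLp 2 (W.mulVec u)⟫ = ∑ i, (∑ j, W i j * u j) ^ 2 := by
    rw [PiLp.inner_apply]; simp [Matrix.mulVec, dotProduct, pow_two]
  rw [← e1, ← e2, ← h1, ← h2, Finset.mul_sum]
  refine Finset.sum_le_sum fun j _ => ?_
  rw [real_inner_comm (hW.eigenvectorBasis j), real_inner_comm (hW.eigenvectorBasis j), aux_spec W hW (WithLp.toLp 2 u) j]
  by_cases hj : j = j0
  · subst hj; rw [hu0]; simp
  · have := sq_le_sq' (by linarith [neg_abs_le (hW.eigenvalues j), hm j hj]) ((le_abs_self _).trans (hm j hj))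
    nlinarith [mul_self_nonneg ⟪hW.eigenvectorBasis j, WithLp.toLp 2 u⟫]

theorem aux_lowE {n p : ℕ} (W : Matrix (Fin n) (Fin n) ℝ) (hW : W.IsHermitian) (m : ℝ)
    (hm : ∀ j, m ≤ hW.eigenvalues j) (u : Fin n → EuclideanSpace ℝ (Fin p)) :
    m * ∑ i, ‖u i‖ ^ 2 ≤ ∑ i, ⟪u i, ∑ j, W i j • u j⟫ := by
  have h := Finset.sum_le_sum fun c (_ : c ∈ Finset.univ) => aux_low W hW m hm (fun i => u i c)
  rw [← Finset.mul_sum, Finset.sum_comm] at h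
  conv_rhs at h => rw [Finset.sum_comm]
  convert h using 3
  · rfl
  · rw [EuclideanSpace.real_norm_sq_eq]
  · simp [PiLp.inner_apply, mul_comm]

theorem aux_contrE {n p : ℕ} (hn : 0 < n) (W : Matrix (Fin n) (Fin n) ℝ) (hW : W.IsHermitian)
    (hrow : ∀ i, ∑ j, W i j = 1) (j0 : Fin n) (β : ℝ) (hβ : β < 1)
    (hm : ∀ j, j ≠ j0 → |hW.eigenvalues j| ≤ β) (u : Fin n → EuclideanSpace ℝ (Fin p))
    (hu : ∑ i, u i = 0) :
    ∑ i, ‖∑ j, W i j • u j‖ ^ 2 ≤ β ^ 2 * ∑ i, ‖u i‖ ^ 2 := by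
  have h := Finset.sum_le_sum fun c (_ : c ∈ Finset.univ) =>
    aux_contr hn W hW hrow j0 β hβ hm (fun i => u i c) (by
      have := congrArg (fun v : EuclideanSpace ℝ (Fin p) => v c) hu
      simpa using this)
  rw [← Finset.mul_sum, Finset.sum_comm] at h
  conv_rhs at h => rw [Finset.sum_comm]
  convert h using 3
  · rfl
  · rw [EuclideanSpace.real_norm_sq_eq]; simp
  · rw [EuclideanSpace.real_norm_sq_eq]

theorem aux_energy {n p : ℕ} (f : Fin n → EuclideanSpace ℝ (Fin p) → ℝ)
    (gf : Fin n → EuclideanSpace ℝ (Fin p) → EuclideanSpace ℝ (Fin p)) (Lh : ℝ)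
    (hgrad : ∀ i z, HasGradientAt (f i) (gf i z) z)
    (hL : ∀ i a b, ‖gf i a - gf i b‖ ≤ Lh * ‖a - b‖)
    (W : Matrix (Fin n) (Fin n) ℝ) (hW : W.IsHermitian) (hnn : ∀ i j, 0 ≤ W i j)
    (hWrow : ∀ i, ∑ j, W i j = 1) (hWcol : ∀ j, ∑ i, W i j = 1)
    (m : ℝ) (hm : ∀ j, m ≤ hW.eigenvalues j)
    (α : ℝ) (hα : 0 < α) (hstep : α * Lh ≤ 1 + m)
    (x : ℕ → Fin n → EuclideanSpace ℝ (Fin p))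
    (hiter : ∀ k i, x (k + 1) i = (∑ j, W i j • x k j) - α • gf i (x k i))
    (hx0 : ∀ i, x 0 i = 0) (k : ℕ) :
    ∑ i, f i (x k i) ≤ ∑ i, f i 0 := by
  let A : (Fin n → EuclideanSpace ℝ (Fin p)) → Fin n → EuclideanSpace ℝ (Fin p) :=
    fun u i => ∑ j, W i j • u j
  have hAadd : ∀ u v i, A (fun i => u i + v i) i = A u i + A v i := by
    intro u v i; simp [A, smul_add, Finset.sum_add_distrib]
  have hsymm : ∀ u v, ∑ i, ⟪u i, A v i⟫ = ∑ i, ⟪v i, A u i⟫ := by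
    intro u v
    simp only [A, inner_sum, inner_smul_right]
    rw [Finset.sum_comm]
    refine Finset.sum_congr rfl fun i _ => Finset.sum_congr rfl fun j _ => ?_
    rw [real_inner_comm]
    have : W j i = W i j := by simpa using hW.apply i j
    rw [this]
  have hnonneg : ∀ u, ∑ i, ⟪u i, A u i⟫ ≤ ∑ i, ‖u i‖ ^ 2 := by
    intro u
    have h1 : ∀ i, ⟪u i, A u i⟫ ≤ ∑ j, (W i j * (‖u i‖ ^ 2 / 2) + W i j * (‖u j‖ ^ 2 / 2)) := by
      intro i
      simp only [A, inner_sum, inner_smul_right]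
      refine Finset.sum_le_sum fun j _ => ?_
      rw [← mul_add]
      refine mul_le_mul_of_nonneg_left ?_ (hnn i j)
      have := real_inner_le_norm (u i) (u j)
      nlinarith [sq_nonneg (‖u i‖ - ‖u j‖)]
    refine (Finset.sum_le_sum fun i _ => h1 i).trans (le_of_eq ?_)
    simp only [Finset.sum_add_distrib, ← Finset.sum_mul, hWrow]
    rw [Finset.sum_comm]
    simp only [← Finset.sum_mul, hWcol, ← Finset.sum_add_distrib]
    refine Finset.sum_congr rfl fun i _ => by ring
  let En : ℕ → ℝ := fun k => (∑ i, ‖x k i‖ ^ 2 - ∑ i, ⟪x k i, A (x k) i⟫) / 2 + α * ∑ i, f i (x k i)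
  have hdec : ∀ k, En (k + 1) ≤ En k := by
    intro k
    let d : Fin n → EuclideanSpace ℝ (Fin p) := fun i => x (k + 1) i - x k i
    have hx : x (k + 1) = fun i => x k i + d i := by funext i; simp [d]
    have hd : ∀ i, d i = A (x k) i - x k i - α • gf i (x k i) := by
      intro i; simp only [d, hiter, A]; abel
    clear_value d
    have hlow : m * ∑ i, ‖d i‖ ^ 2 ≤ ∑ i, ⟪d i, A d i⟫ := aux_lowE W hW m hm d
    have hs := hsymm (x k) d
    have hsm : ∀ i, f i (x k i + d i) ≤ f i (x k i) + ⟪gf i (x k i), d i⟫ + Lh / 2 * ‖d i‖ ^ 2 := by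
      intro i
      have := aux_smooth (f i) (gf i) Lh (hgrad i) (hL i) (x k i) (x k i + d i)
      simpa using this
    have hsm' := Finset.sum_le_sum fun i (_ : i ∈ Finset.univ) => hsm i
    simp only [Finset.sum_add_distrib, ← Finset.mul_sum] at hsm'
    have e1 : ∑ i, ‖x k i + d i‖ ^ 2 = ∑ i, ‖x k i‖ ^ 2 + 2 * ∑ i, ⟪d i, x k i⟫ + ∑ i, ‖d i‖ ^ 2 := by
      simp only [Finset.mul_sum, ← Finset.sum_add_distrib]
      refine Finset.sum_congr rfl fun i _ => ?_
      rw [norm_add_sq_real, real_inner_comm]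
    have e2 : ∑ i, ⟪x k i + d i, A (fun i => x k i + d i) i⟫ = ∑ i, ⟪x k i, A (x k) i⟫
        + ∑ i, ⟪x k i, A d i⟫ + ∑ i, ⟪d i, A (x k) i⟫ + ∑ i, ⟪d i, A d i⟫ := by
      simp only [hAadd, inner_add_left, inner_add_right, Finset.sum_add_distrib]
      ring
    have e3 : ∑ i, ‖d i‖ ^ 2 = ∑ i, ⟪d i, A (x k) i⟫ - ∑ i, ⟪d i, x k i⟫ - α * ∑ i, ⟪gf i (x k i), d i⟫ := by
      simp only [Finset.mul_sum, ← Finset.sum_sub_distrib]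
      refine Finset.sum_congr rfl fun i _ => ?_
      have h := congrArg (fun v => ⟪d i, v⟫) (hd i)
      simp only [inner_sub_right, inner_smul_right, real_inner_self_eq_norm_sq] at h
      rw [h, real_inner_comm (d i) (gf i (x k i))]
    simp only [En]
    rw [hx]
    have hpos : 0 ≤ ∑ i, ‖d i‖ ^ 2 := Finset.sum_nonneg fun i _ => sq_nonneg _
    have h5 := mul_le_mul_of_nonneg_left hsm' hα.le
    have h6 := mul_le_mul_of_nonneg_right hstep hpos
    rw [e1, e2]
    nlinarith
  have hall : ∀ k, En k ≤ En 0 := by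
    intro k
    induction k with
    | zero => exact le_rfl
    | succ k ih => exact (hdec k).trans ih
  have h0 : En 0 = α * ∑ i, f i 0 := by simp [En, hx0]
  have h1 : α * ∑ i, f i (x k i) ≤ En k := by
    simp only [En]; linarith [hnonneg (x k)]
  have h2 := h1.trans ((hall k).trans h0.le)
  exact le_of_mul_le_mul_left h2 hα

theorem aux_cons {n p : ℕ} (hn : 0 < n) (W : Matrix (Fin n) (Fin n) ℝ) (hW : W.IsHermitian)
    (hWrow : ∀ i, ∑ j, W i j = 1) (hWcol : ∀ j, ∑ i, W i j = 1) (j0 : Fin n)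
    (β : ℝ) (hβ0 : 0 ≤ β) (hβ : β < 1)
    (hm : ∀ j, j ≠ j0 → |hW.eigenvalues j| ≤ β)
    (α : ℝ) (hα : 0 < α) (D : ℝ) (hD : 0 ≤ D)
    (x g : ℕ → Fin n → EuclideanSpace ℝ (Fin p))
    (hiter : ∀ k i, x (k + 1) i = (∑ j, W i j • x k j) - α • g k i)
    (hg : ∀ k, ∑ i, ‖g k i‖ ^ 2 ≤ D ^ 2)
    (hx0 : ∀ i, x 0 i = 0)
    (xbar : ℕ → EuclideanSpace ℝ (Fin p)) (hxbar : ∀ k, xbar k = (n : ℝ)⁻¹ • ∑ i, x k i) :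
    (∀ k, xbar (k + 1) = xbar k - α • ((n : ℝ)⁻¹ • ∑ i, g k i)) ∧
    ∀ k i, ‖x k i - xbar k‖ ≤ α * D / (1 - β) := by
  have hn' : (n : ℝ) ≠ 0 := by exact_mod_cast hn.ne'
  have hmean : ∀ k, xbar (k + 1) = xbar k - α • ((n : ℝ)⁻¹ • ∑ i, g k i) := by
    intro k
    simp only [hxbar, hiter, Finset.sum_sub_distrib]
    rw [Finset.sum_comm]
    simp only [← Finset.sum_smul, hWcol, one_smul, ← Finset.smul_sum]
    rw [smul_sub, smul_comm]
  refine ⟨hmean, ?_⟩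
  let V := PiLp 2 (fun _ : Fin n => EuclideanSpace ℝ (Fin p))
  let y : ℕ → Fin n → EuclideanSpace ℝ (Fin p) := fun k i => x k i - xbar k
  let Y : ℕ → V := fun k => WithLp.toLp 2 (y k)
  have hsum : ∀ k, ∑ i, y k i = 0 := by
    intro k
    simp only [y, Finset.sum_sub_distrib, Finset.sum_const, Finset.card_univ, Fintype.card_fin, hxbar]
    rw [← Nat.cast_smul_eq_nsmul ℝ, smul_smul, mul_inv_cancel₀ hn', one_smul, sub_self]
  have hnorm : ∀ u : Fin n → EuclideanSpace ℝ (Fin p), ‖(WithLp.toLp 2 u : V)‖ ^ 2 = ∑ i, ‖u i‖ ^ 2 := by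
    intro u; rw [PiLp.norm_sq_eq_of_L2]
  have hB : ∀ k, ‖Y (k + 1)‖ ≤ β * ‖Y k‖ + α * D := by
    intro k
    let gb := (n : ℝ)⁻¹ • ∑ i, g k i
    let P : V := WithLp.toLp 2 (fun i => ∑ j, W i j • y k j)
    let Q : V := WithLp.toLp 2 (fun i => g k i - gb)
    have hY : Y (k + 1) = P - α • Q := by
      ext1 i
      change x (k + 1) i - xbar (k + 1) = (∑ j, W i j • (x k j - xbar k)) - α • (g k i - gb)
      rw [hmean, hiter]
      simp only [smul_sub, Finset.sum_sub_distrib, ← Finset.sum_smul, hWrow, one_smul, gb]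
      abel
    have hP : ‖P‖ ≤ β * ‖Y k‖ := by
      refine le_of_sq_le_sq ?_ (by positivity)
      rw [mul_pow, hnorm, hnorm]
      exact aux_contrE hn W hW hWrow j0 β hβ hm (y k) (hsum k)
    have hQ : ‖Q‖ ≤ D := by
      refine le_of_sq_le_sq ?_ hD
      rw [hnorm]
      refine le_trans ?_ (hg k)
      have e : ∑ i, ‖g k i - gb‖ ^ 2 = ∑ i, ‖g k i‖ ^ 2 - n * ‖gb‖ ^ 2 := by
        have hs : ∑ i, g k i = (n : ℝ) • gb := by
          simp only [gb]; rw [smul_smul, mul_inv_cancel₀ hn', one_smul]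
        simp only [norm_sub_sq_real, Finset.sum_add_distrib, Finset.sum_sub_distrib, ← Finset.mul_sum,
          ← sum_inner, hs, inner_smul_left, real_inner_self_eq_norm_sq]
        simp; ring
      rw [e]
      have : 0 ≤ (n : ℝ) * ‖gb‖ ^ 2 := by positivity
      linarith
    rw [hY]
    refine (norm_sub_le _ _).trans ?_
    rw [norm_smul, Real.norm_eq_abs, abs_of_pos hα]
    have := mul_le_mul_of_nonneg_left hQ hα.le
    linarith
  have h1b : 0 < 1 - β := by linarith
  have hYb : ∀ k, ‖Y k‖ ≤ α * D / (1 - β) := by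
    intro k
    induction k with
    | zero =>
      have : Y 0 = 0 := by
        ext1 i
        change x 0 i - xbar 0 = 0
        rw [hxbar]; simp [hx0]
      rw [this, norm_zero]; positivity
    | succ k ih =>
      refine (hB k).trans ?_
      have := mul_le_mul_of_nonneg_left ih hβ0
      refine (add_le_add_left this _).trans (le_of_eq ?_)
      field_simp; ring
  intro k i
  exact (PiLp.norm_apply_le (Y k) i).trans (hYb k)

theorem aux_step {E : Type*} [NormedAddCommGroup E] [InnerProductSpace ℝ E] (e G r : E)
    (α δ c ν θ L R : ℝ) (hα : 0 < α) (hδ : 0 < δ) (hν : 0 ≤ ν) (hL : 0 < L) (h0 : 0 ≤ θ) (h1 : θ ≤ 1)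
    (hc : c = (1 - θ) * ν) (hαc : α ≤ θ / L) (hG : ‖G‖ ^ 2 ≤ 2 * L * ⟪G, e⟫)
    (hrsc : ν * ‖e‖ ^ 2 ≤ ⟪G, e⟫) (hr : ‖r‖ ≤ R) :
    ‖e - α • G + α • r‖ ^ 2 ≤ (1 - α * c + α * δ - α ^ 2 * δ * c) * ‖e‖ ^ 2
      + α * (α + δ⁻¹) * R ^ 2 := by
  have hA : ‖e - α • G‖ ^ 2 ≤ (1 - α * c) * ‖e‖ ^ 2 := by
    rw [norm_sub_sq_real, inner_smul_right, norm_smul, Real.norm_eq_abs, abs_of_pos hα,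
      real_inner_comm]
    have a1 : α * L ≤ θ := by rwa [le_div_iff₀ hL] at hαc
    have hGe : 0 ≤ ⟪G, e⟫ := le_trans (by positivity) hrsc
    have a2 : α * ‖G‖ ^ 2 ≤ 2 * θ * ⟪G, e⟫ := by
      have := mul_le_mul_of_nonneg_left hG hα.le
      have := mul_le_mul_of_nonneg_right a1 hGe
      nlinarith
    have a3 := mul_le_mul_of_nonneg_left a2 hα.le
    have a4 : c * ‖e‖ ^ 2 ≤ (1 - θ) * ⟪G, e⟫ := by
      rw [hc, mul_assoc]; exact mul_le_mul_of_nonneg_left hrsc (by linarith)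
    have a5 := mul_le_mul_of_nonneg_left a4 hα.le
    have a6 : 0 ≤ α * ((1 - θ) * ⟪G, e⟫) := by
      have : 0 ≤ 1 - θ := by linarith
      positivity
    nlinarith
  set a := e - α • G
  have hB : ‖a + α • r‖ ^ 2 ≤ (1 + α * δ) * ‖a‖ ^ 2 + α * (α + δ⁻¹) * ‖r‖ ^ 2 := by
    have t := norm_add_le a (α • r)
    rw [norm_smul, Real.norm_eq_abs, abs_of_pos hα] at t
    have t2 : ‖a + α • r‖ ^ 2 ≤ (‖a‖ + α * ‖r‖) ^ 2 := by gcongr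
    refine t2.trans ?_
    have : (1 + α * δ) * ‖a‖ ^ 2 + α * (α + δ⁻¹) * ‖r‖ ^ 2 - (‖a‖ + α * ‖r‖) ^ 2
        = α * δ⁻¹ * (δ * ‖a‖ - ‖r‖) ^ 2 := by
      field_simp; ring
    have : 0 ≤ α * δ⁻¹ * (δ * ‖a‖ - ‖r‖) ^ 2 := by positivity
    linarith
  have hC : ‖r‖ ^ 2 ≤ R ^ 2 := by gcongr
  have hD := mul_le_mul_of_nonneg_left hC (show 0 ≤ α * (α + δ⁻¹) by positivity)
  have hE := mul_le_mul_of_nonneg_left hA (show 0 ≤ 1 + α * δ by positivity)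
  nlinarith


theorem mean_error_recurrence_restricted_strongly_convex
    {n p : ℕ} (hn : 0 < n)
    (f : Fin n → EuclideanSpace ℝ (Fin p) → ℝ)
    (gf : Fin n → EuclideanSpace ℝ (Fin p) → EuclideanSpace ℝ (Fin p))
    (Lf : Fin n → ℝ) (hLfpos : ∀ i, 0 < Lf i)
    (hconv : ∀ i, ConvexOn ℝ Set.univ (f i))
    (hbdd : ∀ i, BddBelow (Set.range (f i)))
    (hgrad : ∀ i z, HasGradientAt (f i) (gf i z) z)
    (hlip : ∀ i, LipschitzWith (Lf i).toNNReal (gf i))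
    (Lh : ℝ) (hLh : Lh = ⨆ i, Lf i)
    (W : Matrix (Fin n) (Fin n) ℝ)
    (hWsymm : W.IsHermitian)
    (hWnonneg : ∀ i j, 0 ≤ W i j)
    (hWrow : ∀ i, ∑ j, W i j = 1)
    (hWcol : ∀ j, ∑ i, W i j = 1)
    (lam : Fin n → ℝ) (hlamAnti : Antitone lam)
    (hlamEig : ∃ σ : Equiv.Perm (Fin n), lam = hWsymm.eigenvalues ∘ σ)
    (hlam1 : lam ⟨0, hn⟩ = 1)
    (lamN : ℝ) (hlamN : lamN = lam ⟨n - 1, Nat.sub_lt hn Nat.one_pos⟩)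
    (hlamNlb : -1 ≤ lamN)
    (β : ℝ) (hβdef : β = ⨆ j : {j : Fin n // j ≠ (⟨0, hn⟩ : Fin n)}, |lam j.1|)
    (α : ℝ) (hα : 0 < α)
    (x : ℕ → Fin n → EuclideanSpace ℝ (Fin p))
    (hiter : ∀ k i, x (k + 1) i = (∑ j, W i j • x k j) - α • gf i (x k i))
    (hx0 : ∀ i, x 0 i = 0)
    (D : ℝ) (hD : D = Real.sqrt (2 * Lh * ((∑ i, f i 0) - ∑ i, ⨅ z, f i z)))
    (xbar : ℕ → EuclideanSpace ℝ (Fin p)) (hxbar : ∀ k, xbar k = (n : ℝ)⁻¹ • ∑ i, x k i)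
    (Lfbar : ℝ) (hLfbar : Lfbar = (n : ℝ)⁻¹ * ∑ i, Lf i)
    (Xstar : Set (EuclideanSpace ℝ (Fin p)))
    (hXstar : Xstar = {z | ∀ w, ∑ i, f i z ≤ ∑ i, f i w})
    (hXne : Xstar.Nonempty)
    (proj : EuclideanSpace ℝ (Fin p) → EuclideanSpace ℝ (Fin p))
    (hproj : ∀ z, proj z ∈ Xstar ∧ ∀ w ∈ Xstar, ‖z - proj z‖ ≤ ‖z - w‖)
    (νf : ℝ) (hνf : 0 < νf)
    (hrsc : ∀ z : EuclideanSpace ℝ (Fin p),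
      νf * ‖z - proj z‖ ^ 2 ≤ ⟪(∑ i, gf i z) - (∑ i, gf i (proj z)), z - proj z⟫)
    (θ : ℝ) (hθ : θ ∈ Set.Icc (0 : ℝ) 1)
    (νfbar : ℝ) (hνfbar : νfbar = νf / n)
    (c₁ : ℝ) (hc1 : c₁ = θ / Lfbar)
    (c₂ : ℝ) (hc2 : c₂ = (1 - θ) * νfbar)
    (ebar : ℕ → EuclideanSpace ℝ (Fin p)) (hebar : ∀ k, ebar k = xbar k - proj (xbar k))
    (hstep : α ≤ min ((1 + lamN) / Lh) c₁)
    (hβlt : β < 1)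
 :
    ∀ δ : ℝ, 0 < δ → ∀ k,
      ‖ebar (k + 1)‖ ^ 2
        ≤ (1 - α * c₂ + α * δ - α ^ 2 * δ * c₂) * ‖ebar k‖ ^ 2
          + α ^ 3 * (α + δ⁻¹) * Lh ^ 2 * D ^ 2 / (1 - β) ^ 2 := by

  intro δ hδ k
  haveI : Nonempty (Fin n) := ⟨⟨0, hn⟩⟩
  have hnR : (0 : ℝ) < n := by exact_mod_cast hn
  have hLle : ∀ i, Lf i ≤ Lh := by
    intro i; rw [hLh]; exact le_ciSup (Set.finite_range Lf).bddAbove i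
  have hLhpos : 0 < Lh := (hLfpos ⟨0, hn⟩).trans_le (hLle _)
  have hlipI : ∀ i a b, ‖gf i a - gf i b‖ ≤ Lf i * ‖a - b‖ := by
    intro i a b
    have := (hlip i).norm_sub_le a b
    rwa [Real.coe_toNNReal _ (hLfpos i).le] at this
  have hlipH : ∀ i a b, ‖gf i a - gf i b‖ ≤ Lh * ‖a - b‖ := fun i a b =>
    (hlipI i a b).trans (mul_le_mul_of_nonneg_right (hLle i) (norm_nonneg _))
  obtain ⟨σ, hσ⟩ := hlamEig
  have heig : ∀ j, hWsymm.eigenvalues j = lam (σ.symm j) := by intro j; simp [hσ]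
  have hmlow : ∀ j, lamN ≤ hWsymm.eigenvalues j := by
    intro j
    rw [heig, hlamN]
    refine hlamAnti ?_
    rw [Fin.le_def]
    have := (σ.symm j).isLt
    simp only; omega
  have hβ0 : 0 ≤ β := by rw [hβdef]; exact Real.iSup_nonneg fun _ => abs_nonneg _
  have hmβ : ∀ j, j ≠ σ ⟨0, hn⟩ → |hWsymm.eigenvalues j| ≤ β := by
    intro j hj
    have hne : σ.symm j ≠ ⟨0, hn⟩ := by
      intro h; apply hj; rw [← h]; simp
    rw [heig, hβdef]
    exact le_ciSup (f := fun j : {j : Fin n // j ≠ (⟨0, hn⟩ : Fin n)} => |lam j.1|)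
      (Set.finite_range _).bddAbove ⟨σ.symm j, hne⟩
  have hst1 : α * Lh ≤ 1 + lamN := by
    have := hstep.trans (min_le_left _ _)
    rwa [le_div_iff₀ hLhpos] at this
  have hst2 : α ≤ θ / Lfbar := by rw [← hc1]; exact hstep.trans (min_le_right _ _)
  have hen := aux_energy f gf Lh hgrad hlipH W hWsymm hWnonneg hWrow hWcol lamN hmlow α hα hst1 x
    hiter hx0
  have hinf : ∀ i z, ⨅ z, f i z ≤ f i z := fun i z => ciInf_le (hbdd i) z
  have hgD : ∀ k, ∑ i, ‖gf i (x k i)‖ ^ 2 ≤ D ^ 2 := by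
    intro k
    have h1 : ∑ i, ‖gf i (x k i)‖ ^ 2 ≤ 2 * Lh * ((∑ i, f i 0) - ∑ i, ⨅ z, f i z) := by
      refine (Finset.sum_le_sum fun i _ => aux_grad_bound (f i) (gf i) Lh hLhpos (hgrad i) (hlipH i)
        (⨅ z, f i z) (hinf i) (x k i)).trans ?_
      rw [← Finset.mul_sum, Finset.sum_sub_distrib]
      refine mul_le_mul_of_nonneg_left ?_ (by positivity)
      linarith [hen k]
    rw [hD, Real.sq_sqrt]
    · exact h1
    · exact le_trans (Finset.sum_nonneg fun i _ => sq_nonneg _) h1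
  have hD0 : 0 ≤ D := by rw [hD]; exact Real.sqrt_nonneg _
  obtain ⟨hmean, hcons⟩ := aux_cons hn W hWsymm hWrow hWcol (σ ⟨0, hn⟩) β hβ0 hβlt hmβ α hα D hD0 x
    (fun k i => gf i (x k i)) hiter hgD hx0 xbar hxbar
  set z := xbar k with hz
  have hSgrad : ∀ w, HasGradientAt (fun w => ∑ i, f i w) (∑ i, gf i w) w := by
    intro w
    rw [hasGradientAt_iff_hasFDerivAt, map_sum]
    exact HasFDerivAt.fun_sum fun i _ => (hgrad i w).hasFDerivAt
  have hpm : ∀ w, ∑ i, f i (proj z) ≤ ∑ i, f i w := by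
    have := (hproj z).1
    rw [hXstar] at this
    exact this
  have hp0 : ∑ i, gf i (proj z) = 0 :=
    aux_min_grad (fun w => ∑ i, f i w) (fun w => ∑ i, gf i w) hSgrad (proj z) hpm
  have hsumL : ∑ i, Lf i = n * Lfbar := by rw [hLfbar]; field_simp
  have hLs : 0 < ∑ i, Lf i := Finset.sum_pos (fun i _ => hLfpos i) Finset.univ_nonempty
  have hLbar : 0 < Lfbar := by rw [hLfbar]; positivity
  have hSlip : ∀ a b, ‖∑ i, gf i a - ∑ i, gf i b‖ ≤ (∑ i, Lf i) * ‖a - b‖ := by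
    intro a b
    rw [← Finset.sum_sub_distrib, Finset.sum_mul]
    exact (norm_sum_le _ _).trans (Finset.sum_le_sum fun i _ => hlipI i a b)
  have hSb := aux_grad_bound (fun w => ∑ i, f i w) (fun w => ∑ i, gf i w) _ hLs hSgrad hSlip _ hpm z
  have hSc : ∑ i, f i z - ∑ i, f i (proj z) ≤ ⟪∑ i, gf i z, z - proj z⟫ := by
    rw [sum_inner, ← Finset.sum_sub_distrib]
    refine Finset.sum_le_sum fun i _ => ?_
    have := aux_first_order (f i) (gf i) (hconv i) (hgrad i) z (proj z)
    rw [← neg_sub z (proj z), inner_neg_right] at this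
    linarith
  have hr := hrsc z
  rw [hp0, sub_zero] at hr
  set GS := ∑ i, gf i z with hGS
  set e := z - proj z with he
  have hSS : ‖GS‖ ^ 2 ≤ 2 * (n * Lfbar) * ⟪GS, e⟫ := by
    rw [← hsumL]
    exact hSb.trans (mul_le_mul_of_nonneg_left hSc (by positivity))
  let r : EuclideanSpace ℝ (Fin p) := (n : ℝ)⁻¹ • ∑ i, (gf i z - gf i (x k i))
  have hrb : ‖r‖ ≤ Lh * (α * D / (1 - β)) := by
    simp only [r]
    rw [norm_smul, Real.norm_eq_abs, abs_of_pos (inv_pos.2 hnR), inv_mul_le_iff₀ hnR]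
    refine (norm_sum_le _ _).trans ?_
    have : ∀ i ∈ Finset.univ, ‖gf i z - gf i (x k i)‖ ≤ Lh * (α * D / (1 - β)) := by
      intro i _
      refine (hlipH i _ _).trans (mul_le_mul_of_nonneg_left ?_ hLhpos.le)
      rw [norm_sub_rev]; exact hcons k i
    refine (Finset.sum_le_sum this).trans (le_of_eq ?_)
    simp
  have hmain := aux_step e ((n : ℝ)⁻¹ • GS) r α δ c₂ νfbar θ Lfbar (Lh * (α * D / (1 - β))) hα hδ
    (by rw [hνfbar]; positivity) hLbar hθ.1 hθ.2 hc2 hst2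
    (by
      rw [norm_smul, Real.norm_eq_abs, abs_of_pos (inv_pos.2 hnR), inner_smul_left, mul_pow]
      refine (mul_le_mul_of_nonneg_left hSS (by positivity)).trans (le_of_eq ?_)
      simp; field_simp)
    (by
      rw [inner_smul_left, hνfbar]
      have := mul_le_mul_of_nonneg_left hr (inv_pos.2 hnR).le
      refine le_trans (le_of_eq ?_) this
      ring) hrb
  have hek : ebar k = e := by rw [hebar]
  have hfin : ‖ebar (k + 1)‖ ≤ ‖e - α • ((n : ℝ)⁻¹ • GS) + α • r‖ := by
    rw [hebar]
    refine ((hproj (xbar (k + 1))).2 (proj z) (hproj z).1).trans (le_of_eq ?_)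
    congr 1
    rw [hmean k]
    simp only [r, Finset.sum_sub_distrib, smul_sub, he, hGS]
    abel
  rw [hek]
  have h1b : (1 - β) ≠ 0 := by linarith
  have hfin2 : ‖ebar (k + 1)‖ ^ 2 ≤ ‖e - α • ((n : ℝ)⁻¹ • GS) + α • r‖ ^ 2 := by gcongr
  refine (hfin2.trans hmain).trans (le_of_eq ?_)
  congr 1
  rw [mul_pow, div_pow, mul_pow]
  ring
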